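/- Let l > 0, let c > 1, and let (n_j)_{j≥0} be a sequence of positive integers with n_{j+1} ≥ c·n_j for all j ≥ 0. Then there exists a constant C > 0, depending only on l and c, such that for every positive integer k, Σ_{j : n_j ≤ k} n_j^l ≤ C · (−1)^k·binom(−l−1, k), where (−1)^k·binom(−l−1, k) = (l+1)(l+2)⋯(l+k)/k! is the k-th coefficient of the binomial series of (1−x)^{−(l+1)}. -/

import Mathlib

open scoped ENNReal

/-- The generalized binomial coefficient `binom(α, k) = α(α−1)⋯(α−k+1)/k!` for `α : ℝ`. -/
noncomputable def genBinom (α : ℝ) (k : ℕ) : ℝ :=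
  (∏ i ∈ Finset.range k, (α - i)) / (k.factorial : ℝ)

theorem neg_one_pow_mul_genBinom_neg_sub_one (l : ℝ) (k : ℕ) :
    (-1 : ℝ) ^ k * genBinom (-l - 1) k = ∏ i ∈ Finset.range k, (1 + l / ((i : ℝ) + 1)) := by
  unfold genBinom
  induction k with
  | zero => simp
  | succ k ih =>
    have hk : (k.factorial : ℝ) ≠ 0 := by positivity
    have hk' : (k : ℝ) + 1 ≠ 0 := by positivity
    rw [Finset.prod_range_succ, Finset.prod_range_succ, ← ih, Nat.factorial_succ]
    push_cast
    field_simp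
    ring

theorem add_div_rpow_le_one_add_div {l x : ℝ} (hl : 0 < l) (hx : 0 < x) :
    ((x + max l 1) / (x + max l 1 - 1)) ^ l ≤ 1 + l / x := by
  rcases le_total l 1 with h | h
  · rw [max_eq_right h]
    have := rpow_one_add_le_one_add_mul_self (s := 1 / x) (by
      have : 0 < 1 / x := by positivity
      linarith) hl.le h
    have e1 : (x + 1) / (x + 1 - 1) = 1 + 1 / x := by
      rw [add_sub_cancel_right]
      field_simp
    rwa [e1, div_eq_mul_one_div l x]
  · rw [max_eq_left h]
    have hxl : 0 < x + l := by positivity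
    have hxl' : 0 < x + l - 1 := by linarith
    have hb := one_add_mul_self_le_rpow_one_add (s := -(1 / (x + l))) (by
      rw [neg_le_neg_iff, div_le_one hxl]
      linarith) h
    have e1 : 1 + l * -(1 / (x + l)) = (1 + l / x)⁻¹ := by
      field_simp
      ring
    have e2 : 1 + -(1 / (x + l)) = ((x + l) / (x + l - 1))⁻¹ := by
      field_simp
      ring
    rw [e1, e2, Real.inv_rpow (by positivity)] at hb
    exact (inv_le_inv₀ (by positivity) (by positivity)).1 hb

theorem add_div_rpow_le_prod_one_add_div {l : ℝ} (hl : 0 < l) (k : ℕ) :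
    (((k : ℝ) + max l 1) / max l 1) ^ l ≤
      ∏ i ∈ Finset.range k, (1 + l / ((i : ℝ) + 1)) := by
  have hm : 0 < max l 1 := lt_max_of_lt_left hl
  induction k with
  | zero => simp [hm.ne']
  | succ k ih =>
    rw [Finset.prod_range_succ]
    have hstep := add_div_rpow_le_one_add_div hl (x := (k : ℝ) + 1) (by positivity)
    have hden : (k : ℝ) + 1 + max l 1 - 1 = k + max l 1 := by ring
    rw [hden] at hstep
    have hsplit : ((k + 1 : ℕ) + max l 1) / max l 1 =
        ((k : ℝ) + max l 1) / max l 1 * (((k : ℝ) + 1 + max l 1) / (k + max l 1)) := by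
      push_cast
      field_simp
    rw [hsplit, Real.mul_rpow (by positivity) (by positivity)]
    gcongr

theorem rpow_le_mul_prod_one_add_div {l : ℝ} (hl : 0 < l) (k : ℕ) :
    (k : ℝ) ^ l ≤ max l 1 ^ l * ∏ i ∈ Finset.range k, (1 + l / ((i : ℝ) + 1)) := by
  have hm : 0 < max l 1 := lt_max_of_lt_left hl
  calc (k : ℝ) ^ l ≤ (max l 1 * (((k : ℝ) + max l 1) / max l 1)) ^ l := by
        gcongr
        rw [mul_div_cancel₀ _ hm.ne']
        linarith
    _ = max l 1 ^ l * (((k : ℝ) + max l 1) / max l 1) ^ l :=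
        Real.mul_rpow hm.le (by positivity)
    _ ≤ _ := by
        gcongr
        exact add_div_rpow_le_prod_one_add_div hl k

theorem sum_range_succ_le_div_of_le_mul {a : ℕ → ℝ} {r : ℝ} (hr : r < 1) (hr0 : 0 ≤ r)
    (ha : ∀ j, 0 ≤ a j) (h : ∀ j, a j ≤ r * a (j + 1)) (N : ℕ) :
    ∑ j ∈ Finset.range (N + 1), a j ≤ a N / (1 - r) := by
  have h1 : 0 < 1 - r := by linarith
  induction N with
  | zero =>
    rw [zero_add, Finset.sum_range_one, le_div_iff₀ h1]
    nlinarith [ha 0]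
  | succ N ih =>
    rw [Finset.sum_range_succ]
    calc _ ≤ r * a (N + 1) / (1 - r) + a (N + 1) := by
          gcongr
          exact ih.trans (by gcongr; exact h N)
      _ = a (N + 1) / (1 - r) := by
          field_simp
          ring

/-- Let `l > 0`, `c > 1`, and let `(n_j)` be positive integers with
`n_{j+1} ≥ c·n_j`.  Then there is a constant `C > 0`, depending only on `l` and `c`, such that
for every positive integer `k`,
`Σ_{j : n_j ≤ k} n_j^l ≤ C · (−1)^k · binom(−l−1, k)`, where `(−1)^k·binom(−l−1,k)` is the
`k`-th coefficient of the binomial series of `(1−x)^{−(l+1)}`. -/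
theorem statement11 (l c : ℝ) (hl : 0 < l) (hc : 1 < c) :
    ∃ C > (0 : ℝ), ∀ (nseq : ℕ → ℕ),
      (∀ j, 0 < nseq j) →
      (∀ j, c * (nseq j : ℝ) ≤ (nseq (j + 1) : ℝ)) →
      ∀ k : ℕ, 0 < k →
        ∑' j : {j : ℕ // nseq j ≤ k}, ENNReal.ofReal ((nseq (j : ℕ) : ℝ) ^ l) ≤
          ENNReal.ofReal (C * ((-1 : ℝ) ^ k * genBinom (-l - 1) k)) := by
  have hr0 : 0 < (c ^ l)⁻¹ := by positivity
  have hr1 : (c ^ l)⁻¹ < 1 := inv_lt_one_of_one_lt₀ (Real.one_lt_rpow hc hl)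
  have h1 : 0 < 1 - (c ^ l)⁻¹ := by linarith
  have hm : 0 < max l 1 := lt_max_of_lt_left hl
  refine ⟨max l 1 ^ l / (1 - (c ^ l)⁻¹), by positivity, fun nseq _ hgrow k _ => ?_⟩
  have hratio : ∀ j, (nseq j : ℝ) ^ l ≤ (c ^ l)⁻¹ * (nseq (j + 1) : ℝ) ^ l := fun j => by
    rw [← div_eq_inv_mul, le_div_iff₀' (by positivity),
      ← Real.mul_rpow (by positivity) (by positivity)]
    gcongr
    exact hgrow j
  rw [neg_one_pow_mul_genBinom_neg_sub_one, ENNReal.tsum_eq_iSup_sum]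
  refine iSup_le fun s => ?_
  rw [← ENNReal.ofReal_sum_of_nonneg fun _ _ => by positivity]
  apply ENNReal.ofReal_le_ofReal
  rcases s.eq_empty_or_nonempty with rfl | hs
  · rw [Finset.sum_empty]
    have : 0 ≤ ∏ i ∈ Finset.range k, (1 + l / ((i : ℝ) + 1)) :=
      Finset.prod_nonneg fun _ _ => by positivity
    positivity
  · set M := s.max' hs
    calc ∑ j ∈ s, (nseq (j : ℕ) : ℝ) ^ l
        = ∑ j ∈ s.map (Function.Embedding.subtype _), (nseq j : ℝ) ^ l := by simp
      _ ≤ ∑ j ∈ Finset.range ((M : ℕ) + 1), (nseq j : ℝ) ^ l := by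
          refine Finset.sum_le_sum_of_subset_of_nonneg (fun j hj => ?_)
            fun _ _ _ => by positivity
          obtain ⟨i, hi, rfl⟩ := Finset.mem_map.1 hj
          exact Finset.mem_range_succ_iff.2 (s.le_max' i hi)
      _ ≤ (nseq M : ℝ) ^ l / (1 - (c ^ l)⁻¹) :=
          sum_range_succ_le_div_of_le_mul hr1 hr0.le (fun _ => by positivity) hratio M
      _ ≤ (k : ℝ) ^ l / (1 - (c ^ l)⁻¹) := by
          gcongr
          exact M.2
      _ ≤ _ := by
          rw [div_mul_eq_mul_div]
          gcongr
          exact rpow_le_mul_prod_one_add_div hl k
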